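/- (Integral representation of the Kawashima function.) Let k=(k_1,…,k_r) be a nonempty index of weight k=wt(k), and let z∈ℂ with Re(z)>−1. Then F_k(z) = ∫_{Δ(k)} ω_{δ(1)}(t_1)⋯ω_{δ(k−1)}(t_{k−1}) · (1−t_k^z)/(1−t_k) dt_k, where ω_0(t)=dt/t, ω_1(t)=dt/(1−t), and δ(j)=1 if j∈A(k), δ(j)=0 otherwise. -/

import Mathlib

open MeasureTheory Filter Topology

namespace Kawashima

/-- The set `A(k) = {k₁, k₁+k₂, …, k₁+⋯+k_{r-1}}` of proper nonempty partial sums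
of an index `k = (k₁, …, k_r)`. -/
def Aset (k : List ℕ) : Finset ℕ :=
  (Finset.Ico 1 k.length).image (fun i => (k.take i).sum)

/-- The Hoffman dual of an index `k`: the unique index `k∨` with the same weight such
that `A(k)` and `A(k∨)` partition `{1, …, wt(k) - 1}`.  It is computed here as the
composition of `wt(k)` whose partial-sum set is the complement of `A(k)`. -/
def hdual (k : List ℕ) : List ℕ :=
  let w := k.sum
  let L := (insert w ((Finset.Icc 1 (w - 1)) \ Aset k)).sort (· ≤ ·)
  L.zipWith (fun a b => a - b) (0 :: L)

/-- `sStar k N = s⋆(k, N) = Σ_{0 < m₁ ≤ ⋯ ≤ m_{r-1} ≤ m_r = N} 1/(m₁^{k₁} ⋯ m_r^{k_r})`.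
For the empty index the value is `1` (empty product), and for a nonempty index and
`N = 0` the value is `0` (empty sum). -/
noncomputable def sStar (k : List ℕ) (N : ℕ) : ℝ :=
  ∑ m : Fin k.length → Fin (N + 1),
    if (∀ i, 0 < (m i : ℕ)) ∧
       (∀ i j : Fin k.length, i ≤ j → (m i : ℕ) ≤ (m j : ℕ)) ∧
       (∀ i : Fin k.length, (i : ℕ) + 1 = k.length → (m i : ℕ) = N)
    then ∏ i : Fin k.length, 1 / ((m i : ℕ) : ℝ) ^ k.get i
    else 0

/-- `SStar k N = S⋆(k, N) = Σ_{n=1}^N s⋆(k, n)`. -/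
noncomputable def SStar (k : List ℕ) (N : ℕ) : ℝ :=
  ∑ n ∈ Finset.Icc 1 N, sStar k n

/-- The binomial coefficient `binom(z, n) = z(z-1)⋯(z-n+1)/n!` for complex `z`. -/
noncomputable def cbinom (z : ℂ) (n : ℕ) : ℂ :=
  (descPochhammer ℂ n).eval z / (n.factorial : ℂ)

/-- The Kawashima function
`F_k(z) = Σ_{n=1}^∞ (-1)^{n-1} s⋆(k∨, n) binom(z, n)`, with `F_∅(z) = 1`. -/
noncomputable def F (k : List ℕ) (z : ℂ) : ℂ :=
  if k = [] then 1
  else ∑' n : ℕ, (-1 : ℂ) ^ n * ((sStar (hdual k) (n + 1) : ℝ) : ℂ) * cbinom z (n + 1)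

/-- The domain `Δ(k) ⊆ (0,1)^{wt(k)}`: `t_j < t_{j+1}` if `j ∈ A(k)` and
`t_j > t_{j+1}` otherwise (positions `1`-indexed). -/
def Delta (k : List ℕ) : Set (Fin k.sum → ℝ) :=
  {t | (∀ j, t j ∈ Set.Ioo (0 : ℝ) 1) ∧
       ∀ (i : Fin k.sum) (h : (i : ℕ) + 1 < k.sum),
         if (i : ℕ) + 1 ∈ Aset k then t i < t ⟨(i : ℕ) + 1, h⟩
         else t ⟨(i : ℕ) + 1, h⟩ < t i}

/-- The multiple zeta value `ζ(k) = Σ_{0 < m₁ < ⋯ < m_r} 1/(m₁^{k₁} ⋯ m_r^{k_r})`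
(as a `tsum`; it converges for admissible `k`), with `ζ(∅) = 1`. -/
noncomputable def mzv (k : List ℕ) : ℝ :=
  ∑' m : Fin k.length → ℕ,
    if (∀ i, 0 < m i) ∧ (∀ i j : Fin k.length, i < j → m i < m j)
    then ∏ i : Fin k.length, 1 / ((m i : ℕ) : ℝ) ^ k.get i
    else 0

/-- `ζ` extended `ℚ`-linearly to formal `ℚ`-linear combinations of indices. -/
noncomputable def zetaL (v : List ℕ →₀ ℚ) : ℝ :=
  v.sum fun k a => (a : ℝ) * mzv k

/-- The Kawashima function extended `ℚ`-linearly to formal combinations of indices. -/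
noncomputable def FL (v : List ℕ →₀ ℚ) (z : ℂ) : ℂ :=
  v.sum fun k a => (a : ℂ) * F k z

/-- Auxiliary harmonic product, on *reversed* indices (so that the rightmost entry of
the index is the head of the list):
`k * l = (k₋ * l, k_r) + (k * l₋, l_s) + (k₋ * l₋, k_r + l_s)`. -/
noncomputable def hstarAux : List ℕ → List ℕ → (List ℕ →₀ ℚ)
  | [], l => Finsupp.single l 1
  | a :: k, [] => Finsupp.single (a :: k) 1
  | a :: k, b :: l =>
      Finsupp.mapDomain (List.cons a) (hstarAux k (b :: l)) +
      Finsupp.mapDomain (List.cons b) (hstarAux (a :: k) l) +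
      Finsupp.mapDomain (List.cons (a + b)) (hstarAux k l)
  termination_by k l => k.length + l.length

/-- The harmonic product `k * l` of two indices, as a `ℚ`-linear combination of
indices. -/
noncomputable def hstar (k l : List ℕ) : List ℕ →₀ ℚ :=
  Finsupp.mapDomain List.reverse (hstarAux k.reverse l.reverse)

/-- Auxiliary product `*̄` on reversed indices:
`k *̄ l = (k₋ *̄ l, k_r) + (k *̄ l₋, l_s) - (k₋ *̄ l₋, k_r + l_s)`. -/
noncomputable def hbarAux : List ℕ → List ℕ → (List ℕ →₀ ℚ)
  | [], l => Finsupp.single l 1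
  | a :: k, [] => Finsupp.single (a :: k) 1
  | a :: k, b :: l =>
      Finsupp.mapDomain (List.cons a) (hbarAux k (b :: l)) +
      Finsupp.mapDomain (List.cons b) (hbarAux (a :: k) l) -
      Finsupp.mapDomain (List.cons (a + b)) (hbarAux k l)
  termination_by k l => k.length + l.length

/-- The harmonic product `k *̄ l` of two indices. -/
noncomputable def hbar (k l : List ℕ) : List ℕ →₀ ℚ :=
  Finsupp.mapDomain List.reverse (hbarAux k.reverse l.reverse)

/-- The product `k ⊛ l = (k₋ * l₋, k_r + l_s)` for nonempty indices `k`, `l`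
(and `0` if either is empty). -/
noncomputable def circAst (k l : List ℕ) : List ℕ →₀ ℚ :=
  match k.reverse, l.reverse with
  | a :: k', b :: l' =>
      Finsupp.mapDomain List.reverse
        (Finsupp.mapDomain (List.cons (a + b)) (hstarAux k' l'))
  | _, _ => 0

/-- `⊛` extended bilinearly to formal combinations. -/
noncomputable def circAstL (v w : List ℕ →₀ ℚ) : List ℕ →₀ ℚ :=
  v.sum fun k a => w.sum fun l b => (a * b) • circAst k l

/-- The star operator `k ↦ k⋆`: the sum over all ways to replace commas by pluses
in groups of consecutive entries,
`(k₁,…,k_r)⋆ = Σ_{0<j₁<⋯<j_q=r} (k₁+⋯+k_{j₁}, …, k_{j_{q-1}+1}+⋯+k_{j_q})`. -/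
noncomputable def starOp : List ℕ → (List ℕ →₀ ℚ)
  | [] => Finsupp.single [] 1
  | [a] => Finsupp.single [a] 1
  | a :: b :: k =>
      Finsupp.mapDomain (List.cons a) (starOp (b :: k)) + starOp ((a + b) :: k)
  termination_by k => k.length

/-- The star operator extended `ℚ`-linearly. -/
noncomputable def starL (v : List ℕ →₀ ℚ) : List ℕ →₀ ℚ :=
  v.sum fun k a => a • starOp k

open Classical in
/-- Kawashima's function `G_k(z)`: the sum over tuples `0 < n₁, …, n_w` with
`n_j < n_{j+1}` if `j ∉ A(k)` and `n_j ≤ n_{j+1}` if `j ∈ A(k)`, of the product of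
the factors `1/(n_j + z)` at positions `j ∈ A(k)`, the factor
`1/n_w - 1/(n_w + z)` at the last position, and `1/n_j` elsewhere. -/
noncomputable def G (k : List ℕ) (z : ℂ) : ℂ :=
  ∑' n : Fin k.sum → ℕ,
    if (∀ j, 0 < n j) ∧
       (∀ (i : Fin k.sum) (h : (i : ℕ) + 1 < k.sum),
          if (i : ℕ) + 1 ∈ Aset k then n i ≤ n ⟨(i : ℕ) + 1, h⟩
          else n i < n ⟨(i : ℕ) + 1, h⟩)
    then ∏ j : Fin k.sum,
      if (j : ℕ) + 1 = k.sum then 1 / ((n j : ℕ) : ℂ) - 1 / (((n j : ℕ) : ℂ) + z)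
      else if (j : ℕ) + 1 ∈ Aset k then 1 / (((n j : ℕ) : ℂ) + z)
      else 1 / ((n j : ℕ) : ℂ)
    else 0

open Classical in
/-- `ζ_k(l) = Σ 1/(n₁^{l₁} ⋯ n_w^{l_w})`, summed over the same set of tuples as in
the definition of `G_k`. -/
noncomputable def zetaIdx (k : List ℕ) (l : List ℕ) : ℝ :=
  ∑' n : Fin k.sum → ℕ,
    if (∀ j, 0 < n j) ∧
       (∀ (i : Fin k.sum) (h : (i : ℕ) + 1 < k.sum),
          if (i : ℕ) + 1 ∈ Aset k then n i ≤ n ⟨(i : ℕ) + 1, h⟩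
          else n i < n ⟨(i : ℕ) + 1, h⟩)
    then ∏ j : Fin k.sum, 1 / ((n j : ℕ) : ℝ) ^ (l.getD (j : ℕ) 0)
    else 0

/-- `C_m(k) = Σ_{l₁,…,l_{r-1} ≥ 0, l_r ≥ 1, l₁+⋯+l_r = m}
ζ_k(1,…,1 (k₁-1 ones), l₁+1, …, 1,…,1 (k_r-1 ones), l_r+1)`. -/
noncomputable def Cm (k : List ℕ) (m : ℕ) : ℝ :=
  ∑ l : Fin k.length → Fin (m + 1),
    if (∑ i, (l i : ℕ)) = m ∧
       (∀ i : Fin k.length, (i : ℕ) + 1 = k.length → 1 ≤ (l i : ℕ))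
    then zetaIdx k
      ((List.ofFn (fun i : Fin k.length =>
          List.replicate (k.get i - 1) 1 ++ [(l i : ℕ) + 1])).flatten)
    else 0

/-- The iterated integral `A_m(k)` over `Δ((k,1,…,1))` (`m` trailing ones) of
`ω_{δ(1)}(t₁) ⋯ ω_{δ(w-1)}(t_{w-1}) · dt_w/(1-t_w) · dt_{w+1}/t_{w+1} ⋯ dt_{w+m}/t_{w+m}`. -/
noncomputable def Aint (k : List ℕ) (m : ℕ) : ℝ :=
  ∫ t in Delta (k ++ List.replicate m 1),
    ∏ i : Fin (k ++ List.replicate m 1).sum,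
      if (i : ℕ) + 1 < k.sum then
        (if (i : ℕ) + 1 ∈ Aset k then 1 / (1 - t i) else 1 / t i)
      else if (i : ℕ) + 1 = k.sum then 1 / (1 - t i)
      else 1 / t i

/-- The digamma function `ψ(z) = Γ'(z)/Γ(z)`. -/
noncomputable def digamma (z : ℂ) : ℂ := deriv Complex.Gamma z / Complex.Gamma z

open scoped ENNReal

lemma cbinom_zero (z : ℂ) : cbinom z 0 = 1 := by simp [cbinom]

lemma cbinom_succ (z : ℂ) (n : ℕ) :
    cbinom z (n + 1) = cbinom z n * (1 - (z + 1) / (n + 1)) * (-1) := by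
  have h1 : ((n : ℂ) + 1) ≠ 0 := by exact_mod_cast Nat.succ_ne_zero n
  have h2 : ((n.factorial : ℕ) : ℂ) ≠ 0 := by exact_mod_cast n.factorial_ne_zero
  simp only [cbinom, descPochhammer_succ_eval, Nat.factorial_succ]
  push_cast
  field_simp
  ring

lemma cbinom_eq_choose (z : ℂ) (n : ℕ) : cbinom z n = Ring.choose z n := by
  rw [Ring.choose_eq_smul, cbinom, div_eq_inv_mul, smul_eq_mul]
  congr 1
  rw [← descPochhammer_map (algebraMap ℤ ℂ), Polynomial.eval_map_algebraMap,
    Polynomial.aeval_eq_smeval]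

lemma hasSum_cbinom_one_sub_pow (z : ℂ) {t : ℝ} (ht : t ∈ Set.Ioo (0 : ℝ) 1) :
    HasSum (fun n : ℕ => (-1 : ℂ) ^ n * cbinom z (n + 1) * (1 - (t : ℂ)) ^ n)
      ((1 - (t : ℂ) ^ z) / (1 - (t : ℂ))) := by
  have hne : (1 - (t : ℂ)) ≠ 0 := by
    rw [sub_ne_zero]
    exact_mod_cast ht.2.ne'
  have hmem : (-(1 - (t : ℂ))) ∈ Metric.eball (0 : ℂ) 1 := by
    rw [← ENNReal.ofReal_one, Metric.eball_ofReal, mem_ball_zero_iff, norm_neg,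
      ← Complex.ofReal_one, ← Complex.ofReal_sub, Complex.norm_real, Real.norm_eq_abs, abs_lt]
    constructor <;> linarith [ht.1, ht.2]
  have h := (Complex.one_add_cpow_hasFPowerSeriesOnBall_zero (a := z)).hasSum hmem
  simp only [binomialSeries_apply, List.ofFn_const, List.prod_replicate, smul_eq_mul,
    zero_add] at h
  rw [← hasSum_nat_add_iff' 1] at h
  have h' := h.mul_right (-(1 - (t : ℂ))⁻¹)
  have hf : (fun n : ℕ => (-1 : ℂ) ^ n * cbinom z (n + 1) * (1 - (t : ℂ)) ^ n) = fun n : ℕ =>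
      Ring.choose z (n + 1) * (-(1 - (t : ℂ))) ^ (n + 1) * -(1 - (t : ℂ))⁻¹ := by
    funext n
    rw [cbinom_eq_choose, neg_pow (1 - (t : ℂ)) (n + 1), pow_succ (-1 : ℂ), pow_succ (1 - (t : ℂ))]
    field_simp
  rw [hf]
  convert! h' using 1
  simp
  field_simp
  ring

lemma norm_one_sub_le_exp (w : ℂ) : ‖1 - w‖ ≤ Real.exp (-w.re + ‖w‖ ^ 2 / 2) := by
  have h : ‖1 - w‖ ^ 2 ≤ Real.exp (-w.re + ‖w‖ ^ 2 / 2) ^ 2 := by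
    rw [← Real.exp_nat_mul]
    refine le_trans (le_of_eq ?_) (Real.add_one_le_exp _)
    rw [Complex.sq_norm, Complex.sq_norm, Complex.normSq_apply, Complex.normSq_apply]
    simp
    ring
  exact le_of_sq_le_sq h (Real.exp_nonneg _)

lemma exists_norm_cbinom_le (z : ℂ) (hz : -1 < z.re) :
    ∃ C : ℝ, 0 ≤ C ∧ ∀ n : ℕ, ‖cbinom z (n + 1)‖ ≤ C * ((n + 1 : ℕ) : ℝ) ^ (-(z.re + 1)) := by
  have hs : Summable fun m : ℕ => ‖(z + 1) / ((m : ℂ) + 1)‖ ^ 2 / 2 := by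
    have h0 := (summable_nat_add_iff 1).2 (Real.summable_one_div_nat_pow.2 one_lt_two)
    refine (h0.mul_left (‖z + 1‖ ^ 2 / 2)).congr fun m => ?_
    rw [norm_div, div_pow, ← Nat.cast_succ, Complex.norm_natCast]
    ring
  set S := ∑' m : ℕ, ‖(z + 1) / ((m : ℂ) + 1)‖ ^ 2 / 2 with hS
  have key : ∀ n : ℕ, ‖cbinom z n‖ ≤ Real.exp (∑ m ∈ Finset.range n,
      (-((z + 1) / ((m : ℂ) + 1)).re + ‖(z + 1) / ((m : ℂ) + 1)‖ ^ 2 / 2)) := by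
    intro n
    induction n with
    | zero => simp [cbinom_zero]
    | succ n ih =>
      rw [cbinom_succ, norm_mul, norm_mul, norm_neg, norm_one, mul_one, Finset.sum_range_succ,
        Real.exp_add]
      exact mul_le_mul ih (norm_one_sub_le_exp _) (norm_nonneg _) (Real.exp_nonneg _)
  refine ⟨Real.exp S, Real.exp_nonneg _, fun n => (key (n + 1)).trans ?_⟩
  have hpos : (0 : ℝ) < ((n + 1 : ℕ) : ℝ) := by positivity
  rw [Real.rpow_def_of_pos hpos, ← Real.exp_add, Real.exp_le_exp, Finset.sum_add_distrib]
  have h1 : ∑ m ∈ Finset.range (n + 1), ‖(z + 1) / ((m : ℂ) + 1)‖ ^ 2 / 2 ≤ S :=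
    hs.sum_le_tsum _ fun _ _ => by positivity
  have h2 : ∑ m ∈ Finset.range (n + 1), (-((z + 1) / ((m : ℂ) + 1)).re) =
      -((z.re + 1) * (harmonic (n + 1) : ℝ)) := by
    rw [harmonic]
    push_cast
    rw [Finset.mul_sum, ← Finset.sum_neg_distrib]
    refine Finset.sum_congr rfl fun m _ => ?_
    rw [← Nat.cast_succ, Complex.div_natCast_re]
    simp [div_eq_mul_inv]
  have h3 : Real.log ((n + 1 : ℕ) : ℝ) ≤ (harmonic (n + 1) : ℝ) := by
    refine le_trans (Real.log_le_log hpos ?_) (log_add_one_le_harmonic (n + 1))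
    push_cast
    linarith
  have h4 := mul_le_mul_of_nonneg_left h3 (by linarith : 0 ≤ z.re + 1)
  rw [h2]
  linarith

/-- The moments `∫ (1 - t)ⁿ` of the iterated integral attached to `A`, given by their recursion
on the number of integration variables. -/
noncomputable def moment (A : Finset ℕ) : ℕ → ℕ → ℝ
  | 0, n => 1 / (n + 1)
  | v + 1, n =>
    if v + 1 ∈ A then moment A v n / (n + 1)
    else (∑ m ∈ Finset.range (n + 1), moment A v m) / (n + 1)

lemma moment_nonneg (A : Finset ℕ) (v n : ℕ) : 0 ≤ moment A v n := by
  induction v generalizing n with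
  | zero => rw [moment]; positivity
  | succ v ih =>
    rw [moment]
    split_ifs
    · exact div_nonneg (ih n) (by positivity)
    · exact div_nonneg (Finset.sum_nonneg fun m _ => ih m) (by positivity)

lemma harmonic_real_eq (n : ℕ) :
    (harmonic n : ℝ) = ∑ m ∈ Finset.range n, 1 / ((m : ℝ) + 1) := by
  simp [harmonic]

lemma harmonic_real_mono {m n : ℕ} (h : m ≤ n) : (harmonic m : ℝ) ≤ harmonic n := by
  rw [harmonic_real_eq, harmonic_real_eq]
  exact Finset.sum_le_sum_of_subset_of_nonneg (Finset.range_mono h) fun _ _ _ => by positivity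

lemma one_le_harmonic_succ (n : ℕ) : (1 : ℝ) ≤ harmonic (n + 1) := by
  have h := harmonic_real_mono (Nat.le_add_left 1 n)
  simpa [harmonic] using h

lemma moment_le (A : Finset ℕ) (v n : ℕ) :
    moment A v n ≤ (harmonic (n + 1) : ℝ) ^ v / (n + 1) := by
  induction v generalizing n with
  | zero => simp [moment]
  | succ v ih =>
    rw [moment]
    have hH := one_le_harmonic_succ n
    split_ifs
    · gcongr
      refine (ih n).trans ((div_le_self (by positivity) (by linarith [n.cast_nonneg (α := ℝ)])).trans
        (pow_le_pow_right₀ hH v.le_succ))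
    · gcongr
      rw [pow_succ, harmonic_real_eq (n + 1), Finset.mul_sum, ← harmonic_real_eq]
      refine Finset.sum_le_sum fun m hm => (ih m).trans ?_
      rw [← mul_one_div]
      have := harmonic_real_mono (Finset.mem_range.1 hm)
      have h0 := one_le_harmonic_succ m
      gcongr

lemma summable_norm_cbinom_mul_moment (A : Finset ℕ) (v : ℕ) (z : ℂ) (hz : -1 < z.re) :
    Summable fun n : ℕ => ‖cbinom z (n + 1)‖ * moment A v n := by
  obtain ⟨C, hC, hb⟩ := exists_norm_cbinom_le z hz
  set ε : ℝ := (z.re + 1) / (2 * (v + 1)) with hε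
  have hε0 : 0 < ε := div_pos (by linarith) (by positivity)
  have hεv : ε * v ≤ (z.re + 1) / 2 := by
    rw [hε, div_mul_eq_mul_div, div_le_div_iff₀ (by positivity) two_pos]
    nlinarith
  have hs : Summable fun n : ℕ =>
      C * (1 + 1 / ε) ^ v * ((n + 1 : ℕ) : ℝ) ^ (-(1 + (z.re + 1) / 2)) :=
    ((summable_nat_add_iff 1).2 (Real.summable_nat_rpow.2 (by linarith))).mul_left _
  refine hs.of_nonneg_of_le (fun n => mul_nonneg (norm_nonneg _) (moment_nonneg A v n)) fun n => ?_
  set N : ℝ := ((n + 1 : ℕ) : ℝ) with hN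
  have hN1 : 1 ≤ N := by rw [hN]; push_cast; linarith [n.cast_nonneg (α := ℝ)]
  have hN0 : 0 < N := by linarith
  have hH : (harmonic (n + 1) : ℝ) ≤ (1 + 1 / ε) * N ^ ε := by
    have h1 := harmonic_le_one_add_log (n + 1)
    have h2 := Real.log_le_rpow_div hN0.le hε0
    have h3 := Real.one_le_rpow hN1 hε0.le
    calc (harmonic (n + 1) : ℝ) ≤ 1 + Real.log N := h1
      _ ≤ N ^ ε + N ^ ε / ε := add_le_add h3 h2
      _ = (1 + 1 / ε) * N ^ ε := by ring
  have hHv : (harmonic (n + 1) : ℝ) ^ v ≤ (1 + 1 / ε) ^ v * N ^ ((z.re + 1) / 2) := by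
    have h0 := one_le_harmonic_succ n
    calc (harmonic (n + 1) : ℝ) ^ v ≤ ((1 + 1 / ε) * N ^ ε) ^ v := by gcongr
      _ = (1 + 1 / ε) ^ v * N ^ (ε * v) := by
        rw [mul_pow, Real.rpow_mul hN0.le, Real.rpow_natCast]
      _ ≤ _ := by gcongr
  have hm : moment A v n ≤ (1 + 1 / ε) ^ v * N ^ ((z.re + 1) / 2) / N := by
    refine (moment_le A v n).trans ?_
    have : (n : ℝ) + 1 = N := by rw [hN]; push_cast; rfl
    rw [this]
    gcongr
  calc ‖cbinom z (n + 1)‖ * moment A v n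
      ≤ (C * N ^ (-(z.re + 1))) * ((1 + 1 / ε) ^ v * N ^ ((z.re + 1) / 2) / N) :=
        mul_le_mul (hb n) hm (moment_nonneg A v n) (by positivity)
    _ = C * (1 + 1 / ε) ^ v * N ^ (-(1 + (z.re + 1) / 2)) := by
      have : N ^ (-(1 + (z.re + 1) / 2)) =
          N ^ (-(z.re + 1)) * N ^ ((z.re + 1) / 2) * N ^ (-1 : ℝ) := by
        rw [← Real.rpow_add hN0, ← Real.rpow_add hN0]
        congr 1
        ring
      rw [this, Real.rpow_neg_one]
      ring

/-- Weakly increasing tuples with entries in `{1, …, N}`. -/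
def monoTuples (r N : ℕ) : Finset (Fin (r + 1) → ℕ) :=
  {m ∈ Fintype.piFinset fun _ => Finset.Icc 1 N | ∀ i j : Fin (r + 1), i ≤ j → m i ≤ m j}

lemma mem_monoTuples {r N : ℕ} {m : Fin (r + 1) → ℕ} :
    m ∈ monoTuples r N ↔ (∀ i, 1 ≤ m i ∧ m i ≤ N) ∧ ∀ i j, i ≤ j → m i ≤ m j := by
  simp [monoTuples]

/-- The truncated star sum `s⋆` for an exponent vector indexed by `Fin (r + 1)`. -/
noncomputable def chainSum {r : ℕ} (κ : Fin (r + 1) → ℕ) (N : ℕ) : ℝ :=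
  ∑ m ∈ monoTuples r N with m (Fin.last r) = N, ∏ i, 1 / (m i : ℝ) ^ κ i

lemma chainSum_snoc_succ {r : ℕ} (κ : Fin r → ℕ) (a N : ℕ) :
    chainSum (Fin.snoc κ (a + 1) : Fin (r + 1) → ℕ) N =
      chainSum (Fin.snoc κ a : Fin (r + 1) → ℕ) N / N := by
  rw [chainSum, chainSum, Finset.sum_div]
  refine Finset.sum_congr rfl fun m hm => ?_
  rw [Fin.prod_univ_castSucc, Fin.prod_univ_castSucc]
  simp only [Fin.snoc_castSucc, Fin.snoc_last, (Finset.mem_filter.1 hm).2]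
  rw [pow_succ]
  ring

lemma sum_chainSum {r : ℕ} (κ : Fin (r + 1) → ℕ) (N : ℕ) :
    ∑ M ∈ Finset.Icc 1 N, chainSum κ M = ∑ m ∈ monoTuples r N, ∏ i, 1 / (m i : ℝ) ^ κ i := by
  rw [← Finset.sum_fiberwise_of_maps_to (t := Finset.Icc 1 N)
    (g := fun m : Fin (r + 1) → ℕ => m (Fin.last r))]
  · refine Finset.sum_congr rfl fun M hM => Finset.sum_congr ?_ fun _ _ => rfl
    ext m
    simp only [Finset.mem_filter, mem_monoTuples]
    refine and_congr_left fun h => and_congr_left fun hmono => forall_congr' fun i => ?_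
    have h1 := hmono i (Fin.last r) (Fin.le_last i)
    have h2 := (Finset.mem_Icc.1 hM).2
    omega
  · intro m hm
    exact Finset.mem_Icc.2 ((mem_monoTuples.1 hm).1 _)

lemma chainSum_snoc_one {r : ℕ} (κ : Fin (r + 1) → ℕ) {N : ℕ} (hN : 1 ≤ N) :
    chainSum (Fin.snoc κ 1 : Fin (r + 2) → ℕ) N = (∑ M ∈ Finset.Icc 1 N, chainSum κ M) / N := by
  rw [sum_chainSum, chainSum, Finset.sum_div]
  refine Finset.sum_nbij' (fun m i => m i.castSucc) (fun m => Fin.snoc m N) ?_ ?_ ?_ ?_ ?_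
  · intro m hm
    simp only [Finset.mem_filter, mem_monoTuples] at hm ⊢
    exact ⟨fun i => hm.1.1 _, fun i j hij => hm.1.2 _ _ (Fin.castSucc_le_castSucc_iff.2 hij)⟩
  · intro m hm
    simp only [Finset.mem_filter, mem_monoTuples] at hm ⊢
    refine ⟨⟨fun i => ?_, fun i j => ?_⟩, by simp⟩
    · induction i using Fin.lastCases with
      | last => simpa using hN
      | cast i => simpa using hm.1 i
    · induction j using Fin.lastCases with
      | last =>
        intro _
        induction i using Fin.lastCases with
        | last => simp
        | cast i => simpa using (hm.1 i).2
      | cast j =>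
        induction i using Fin.lastCases with
        | last => intro h; exact absurd (Fin.castSucc_lt_last j) (not_lt.2 h)
        | cast i => intro h; simpa using hm.2 i j (Fin.castSucc_le_castSucc_iff.1 h)
  · intro m hm
    funext i
    induction i using Fin.lastCases with
    | last => simpa using ((Finset.mem_filter.1 hm).2).symm
    | cast i => simp
  · intro m _
    funext i
    simp
  · intro m hm
    rw [Fin.prod_univ_castSucc]
    simp [(Finset.mem_filter.1 hm).2, div_eq_mul_inv]

lemma chainSum_fin_one (κ : Fin 1 → ℕ) (n : ℕ) :
    chainSum κ (n + 1) = 1 / ((n + 1 : ℕ) : ℝ) ^ κ 0 := by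
  have h : ({m ∈ monoTuples 0 (n + 1) | m (Fin.last 0) = n + 1} : Finset (Fin 1 → ℕ)) =
      {fun _ => n + 1} := by
    ext m
    simp only [Finset.mem_filter, mem_monoTuples, Finset.mem_singleton]
    constructor
    · rintro ⟨_, h⟩
      funext i
      rw [Subsingleton.elim i (Fin.last 0), h]
    · rintro rfl
      simp
  rw [chainSum, h, Finset.sum_singleton, Fin.prod_univ_one]

lemma sum_fin_eq_chainSum {r s : ℕ} (h : s = r + 1) (κ : Fin s → ℕ) (N : ℕ) :
    (∑ m : Fin s → Fin (N + 1),
      if (∀ i, 0 < (m i : ℕ)) ∧ (∀ i j : Fin s, i ≤ j → (m i : ℕ) ≤ (m j : ℕ)) ∧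
        (∀ i : Fin s, (i : ℕ) + 1 = s → (m i : ℕ) = N)
      then ∏ i : Fin s, 1 / ((m i : ℕ) : ℝ) ^ κ i else 0) =
    chainSum (fun i => κ (Fin.cast h.symm i)) N := by
  subst h
  rw [← Finset.sum_filter, chainSum]
  refine Finset.sum_nbij' (fun m i => (m i : ℕ)) (fun m i => ⟨min (m i) N, by omega⟩) ?_ ?_ ?_ ?_ ?_
  · intro m hm
    simp only [Finset.mem_filter, mem_monoTuples, Finset.mem_univ, true_and] at hm ⊢
    exact ⟨⟨fun i => ⟨hm.1 i, Nat.lt_succ_iff.1 (m i).2⟩, hm.2.1⟩, hm.2.2 _ (by simp)⟩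
  · intro m hm
    simp only [Finset.mem_filter, mem_monoTuples, Finset.mem_univ, true_and] at hm ⊢
    refine ⟨fun i => ?_, fun i j hij => ?_, fun i hi => ?_⟩
    · have := hm.1.1 i
      omega
    · have := hm.1.2 i j hij
      omega
    · have : i = Fin.last r := Fin.ext (by simpa using hi)
      rw [this, hm.2, min_self]
  · intro m hm
    funext i
    exact Fin.ext (min_eq_left (Nat.lt_succ_iff.1 (m i).2))
  · intro m hm
    funext i
    exact min_eq_left ((mem_monoTuples.1 (Finset.mem_filter.1 hm).1).1 i).2
  · intro m _
    simp

lemma sStar_append_singleton (l : List ℕ) (a N : ℕ) :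
    sStar (l ++ [a]) N = chainSum (Fin.snoc l.get a : Fin (l.length + 1) → ℕ) N := by
  have h : (l ++ [a]).length = l.length + 1 := by simp
  rw [sStar, sum_fin_eq_chainSum h]
  congr 1
  funext i
  induction i using Fin.lastCases with
  | last => simp
  | cast i => simp

lemma sStar_append_succ (l : List ℕ) (a N : ℕ) :
    sStar (l ++ [a + 1]) N = sStar (l ++ [a]) N / N := by
  rw [sStar_append_singleton, sStar_append_singleton, chainSum_snoc_succ]

lemma sStar_append_one (l : List ℕ) (a n : ℕ) :
    sStar (l ++ [a] ++ [1]) (n + 1) =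
      (∑ m ∈ Finset.range (n + 1), sStar (l ++ [a]) (m + 1)) / (n + 1) := by
  have h : (l ++ [a]).length = l.length + 1 := by simp
  have h' : ((l ++ [a]) ++ [1]).length = (l.length + 1) + 1 := by simp
  rw [sStar, sum_fin_eq_chainSum h']
  have hκ : (fun i => (l ++ [a] ++ [1]).get (Fin.cast h'.symm i)) =
      (Fin.snoc (fun i => (l ++ [a]).get (Fin.cast h.symm i)) 1 : Fin (l.length + 2) → ℕ) := by
    funext i
    induction i using Fin.lastCases with
    | last => simp
    | cast i =>
      have hi := i.2
      simp only [List.get_eq_getElem, List.append_assoc, List.getElem_append, Fin.val_cast,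
        Fin.val_castSucc, Fin.snoc_castSucc]
      split_ifs
      · rfl
      · simp [show (i : ℕ) - l.length = 0 by omega]
      · exact absurd (show (i : ℕ) - l.length < [a].length by simp; omega) ‹_›
  rw [hκ, chainSum_snoc_one _ (Nat.le_add_left 1 n), Finset.range_eq_Ico,
    Finset.sum_Ico_add' (fun m => sStar (l ++ [a]) m) 0 (n + 1) 1]
  push_cast
  congr 1
  refine Finset.sum_congr ?_ fun M _ => ?_
  · ext; simp
  · rw [sStar, sum_fin_eq_chainSum h]

/-- The composition of `w` with partial-sum set `B`. -/
def compositionOf (w : ℕ) (B : Finset ℕ) : List ℕ :=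
  let L := (insert w B).sort (· ≤ ·)
  L.zipWith (fun a b => a - b) (0 :: L)

lemma zipWith_sub_append (L : List ℕ) (w c : ℕ) :
    (L ++ [w]).zipWith (fun a b => a - b) (c :: (L ++ [w])) =
      L.zipWith (fun a b => a - b) (c :: L) ++ [w - L.getLastD c] := by
  induction L generalizing c with
  | nil => simp
  | cons a L ih =>
    have := ih a
    simp only [List.cons_append, List.zipWith_cons_cons, this, List.getLastD_cons]

lemma sort_insert_of_lt {w : ℕ} {B : Finset ℕ} (hB : ∀ b ∈ B, b < w) :
    (insert w B).sort (· ≤ ·) = B.sort (· ≤ ·) ++ [w] := by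
  have hw : w ∉ B := fun h => lt_irrefl _ (hB w h)
  refine List.Perm.eq_of_pairwise' (r := (· ≤ ·)) (Finset.pairwise_sort _ _) ?_ ?_
  · rw [List.pairwise_append]
    refine ⟨Finset.pairwise_sort _ _, by simp, fun a ha b hb => ?_⟩
    rw [List.mem_singleton.1 hb]
    exact (hB a ((Finset.mem_sort _).1 ha)).le
  · rw [← Multiset.coe_eq_coe, ← Multiset.coe_add, Finset.sort_eq, Finset.sort_eq,
      Finset.insert_val_of_notMem hw, add_comm]
    rfl

lemma compositionOf_eq {w : ℕ} {B : Finset ℕ} (hB : ∀ b ∈ B, b < w) :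
    compositionOf w B = (B.sort (· ≤ ·)).zipWith (fun a b => a - b) (0 :: B.sort (· ≤ ·)) ++
      [w - (B.sort (· ≤ ·)).getLastD 0] := by
  rw [compositionOf, sort_insert_of_lt hB]
  exact zipWith_sub_append _ _ _

lemma getLastD_sort_lt {w : ℕ} {B : Finset ℕ} (hB : ∀ b ∈ B, b < w) (hw : 0 < w) :
    (B.sort (· ≤ ·)).getLastD 0 < w := by
  rcases List.eq_nil_or_concat (B.sort (· ≤ ·)) with h | ⟨L, b, h⟩
  · simpa [h] using hw
  · rw [h]
    simp only [List.concat_eq_append, List.getLastD_concat]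
    exact hB b ((Finset.mem_sort (· ≤ ·)).1 (by simp [h]))

lemma compositionOf_insert {w : ℕ} {B : Finset ℕ} (hB : ∀ b ∈ B, b < w) :
    compositionOf (w + 1) (insert w B) = compositionOf w B ++ [1] := by
  rw [compositionOf_eq (w := w + 1), sort_insert_of_lt hB, compositionOf, sort_insert_of_lt hB]
  · simp
  · intro b hb
    rcases Finset.mem_insert.1 hb with rfl | hb
    · omega
    · exact (hB b hb).trans w.lt_succ_self

lemma sStar_compositionOf (A : Finset ℕ) (v n : ℕ) :
    sStar (compositionOf (v + 1) (Finset.Icc 1 v \ A)) (n + 1) = moment A v n := by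
  induction v generalizing n with
  | zero =>
    have h : compositionOf (0 + 1) (Finset.Icc 1 0 \ A) = [] ++ [0 + 1] := by
      simp [compositionOf]
    rw [h, sStar_append_succ, sStar_append_singleton, moment]
    refine (congrArg (· / ((n + 1 : ℕ) : ℝ)) (chainSum_fin_one _ n)).trans ?_
    simp [Fin.snoc]
  | succ v ih =>
    have hB : ∀ b ∈ Finset.Icc 1 v \ A, b < v + 1 := fun b hb => by
      have := (Finset.mem_Icc.1 (Finset.mem_sdiff.1 hb).1).2
      omega
    have hlt := getLastD_sort_lt hB v.succ_pos
    rw [moment]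
    split_ifs with hA
    · have hset : Finset.Icc 1 (v + 1) \ A = Finset.Icc 1 v \ A := by
        ext b
        simp only [Finset.mem_sdiff, Finset.mem_Icc]
        have : b ∉ A → b ≠ v + 1 := by rintro h rfl; exact h hA
        constructor <;> rintro ⟨h1, h2⟩ <;> have := this h2 <;> exact ⟨by omega, h2⟩
      rw [hset, compositionOf_eq (fun b hb => (hB b hb).trans (v + 1).lt_succ_self), ← ih,
        compositionOf_eq hB, Nat.succ_sub hlt.le, sStar_append_succ]
      push_cast
      rfl
    · have hset : Finset.Icc 1 (v + 1) \ A = insert (v + 1) (Finset.Icc 1 v \ A) := by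
        ext b
        simp only [Finset.mem_sdiff, Finset.mem_Icc, Finset.mem_insert]
        have : b = v + 1 → b ∉ A := by rintro rfl; exact hA
        constructor
        · rintro ⟨h1, h2⟩
          by_cases h : b = v + 1
          · exact Or.inl h
          · exact Or.inr ⟨by omega, h2⟩
        · rintro (h | ⟨h1, h2⟩)
          · exact ⟨by omega, this h⟩
          · exact ⟨by omega, h2⟩
      rw [hset, compositionOf_insert hB, compositionOf_eq hB, sStar_append_one]
      simp only [← compositionOf_eq hB, ih]

/-- The open domain cut out by `0 < t_j < 1` and the inequalities between neighbours
prescribed by `A`. -/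
def chainRegion (A : Finset ℕ) (w : ℕ) : Set (Fin w → ℝ) :=
  {t | (∀ j, t j ∈ Set.Ioo (0 : ℝ) 1) ∧
       ∀ (i : Fin w) (h : (i : ℕ) + 1 < w),
         if (i : ℕ) + 1 ∈ A then t i < t ⟨(i : ℕ) + 1, h⟩
         else t ⟨(i : ℕ) + 1, h⟩ < t i}

/-- The density of the form `ω_δ` in position `i` (counted from `0`). -/
noncomputable def formWeight (A : Finset ℕ) (i : ℕ) (x : ℝ) : ℝ :=
  if i + 1 ∈ A then 1 / (1 - x) else 1 / x

lemma measurable_formWeight (A : Finset ℕ) (i : ℕ) : Measurable (formWeight A i) := by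
  unfold formWeight
  split_ifs <;> fun_prop

lemma formWeight_nonneg (A : Finset ℕ) (i : ℕ) {x : ℝ} (hx : x ∈ Set.Ioo (0 : ℝ) 1) :
    0 ≤ formWeight A i x := by
  unfold formWeight
  have h1 := hx.1
  have h2 := hx.2
  split_ifs
  · exact one_div_nonneg.2 (by linarith)
  · exact one_div_nonneg.2 h1.le

lemma measurableSet_chainRegion (A : Finset ℕ) (w : ℕ) : MeasurableSet (chainRegion A w) := by
  have h : chainRegion A w = (⋂ j : Fin w, {t | t j ∈ Set.Ioo (0 : ℝ) 1}) ∩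
      ⋂ (i : Fin w) (h : (i : ℕ) + 1 < w), {t : Fin w → ℝ |
        if (i : ℕ) + 1 ∈ A then t i < t ⟨(i : ℕ) + 1, h⟩ else t ⟨(i : ℕ) + 1, h⟩ < t i} := by
    ext t
    simp [chainRegion]
  rw [h]
  refine MeasurableSet.inter (MeasurableSet.iInter fun j => (measurable_pi_apply j) measurableSet_Ioo)
    (MeasurableSet.iInter fun i => MeasurableSet.iInter fun h => ?_)
  split_ifs
  · exact measurableSet_lt (measurable_pi_apply _) (measurable_pi_apply _)
  · exact measurableSet_lt (measurable_pi_apply _) (measurable_pi_apply _)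

/-- The range of the last coordinate over a point with previous coordinate `s`. -/
def lastRange (A : Finset ℕ) (v : ℕ) (s : ℝ) : Set ℝ :=
  {x | x ∈ Set.Ioo (0 : ℝ) 1 ∧ if v + 1 ∈ A then s < x else x < s}

lemma measurableSet_lastRange (A : Finset ℕ) (v : ℕ) (s : ℝ) :
    MeasurableSet (lastRange A v s) := by
  unfold lastRange
  split_ifs
  · exact measurableSet_Ioo.inter measurableSet_Ioi
  · exact measurableSet_Ioo.inter measurableSet_Iio

lemma snoc_mem_chainRegion {A : Finset ℕ} {v : ℕ} {y : Fin (v + 1) → ℝ} {x : ℝ} :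
    (Fin.snoc y x : Fin (v + 2) → ℝ) ∈ chainRegion A (v + 2) ↔
      y ∈ chainRegion A (v + 1) ∧ x ∈ lastRange A v (y (Fin.last v)) := by
  have hs : ∀ (i : ℕ) (h : i < v + 1),
      (Fin.snoc y x : Fin (v + 2) → ℝ) ⟨i, by omega⟩ = y ⟨i, h⟩ := fun i h =>
    Fin.snoc_castSucc (α := fun _ => ℝ) x y ⟨i, h⟩
  have hl : (Fin.snoc y x : Fin (v + 2) → ℝ) ⟨v + 1, by omega⟩ = x :=
    Fin.snoc_last (α := fun _ => ℝ) x y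
  constructor
  · rintro ⟨h1, h2⟩
    refine ⟨⟨fun j => ?_, fun i h => ?_⟩, ?_, ?_⟩
    · have := h1 ⟨j, by omega⟩
      rwa [hs j j.2] at this
    · have := h2 ⟨i, by omega⟩ (by simp; omega)
      simp only [hs i i.2, hs (i + 1) h] at this
      exact this
    · have := h1 ⟨v + 1, by omega⟩
      rwa [hl] at this
    · have := h2 ⟨v, by omega⟩ (by simp)
      simp only [hs v v.lt_succ_self, hl] at this
      exact this
  · rintro ⟨⟨h1, h2⟩, h3, h4⟩
    refine ⟨fun j => ?_, fun i h => ?_⟩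
    · induction j using Fin.lastCases with
      | last => simpa using h3
      | cast j => simpa using h1 j
    · obtain ⟨i, hi⟩ := i
      simp only at h ⊢
      rw [hs i (by omega)]
      rcases Nat.lt_or_ge (i + 1) (v + 1) with h' | h'
      · rw [hs (i + 1) h']
        exact h2 ⟨i, by omega⟩ h'
      · obtain rfl : i = v := by omega
        rw [hl]
        exact h4

/-- The iterated integral over `chainRegion A (v + 1)` with the density `f` in the last variable. -/
noncomputable def chainLIntegral (A : Finset ℕ) (v : ℕ) (f : ℝ → ℝ≥0∞) : ℝ≥0∞ :=
  ∫⁻ t in chainRegion A (v + 1),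
    (∏ i : Fin v, ENNReal.ofReal (formWeight A i (t i.castSucc))) * f (t (Fin.last v))

lemma measurable_prod_formWeight (A : Finset ℕ) (v : ℕ) :
    Measurable fun t : Fin (v + 1) → ℝ =>
      ∏ i : Fin v, ENNReal.ofReal (formWeight A i (t i.castSucc)) :=
  Finset.measurable_prod _ fun i _ =>
    ((measurable_formWeight A i).comp (measurable_pi_apply _)).ennreal_ofReal

lemma chainLIntegral_succ (A : Finset ℕ) (v : ℕ) {f : ℝ → ℝ≥0∞} (hf : Measurable f) :
    chainLIntegral A (v + 1) f = chainLIntegral A v fun s =>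
      ENNReal.ofReal (formWeight A v s) * ∫⁻ x in lastRange A v s, f x := by
  have hmeas : Measurable ((chainRegion A (v + 2)).indicator fun t : Fin (v + 2) → ℝ =>
      (∏ i : Fin (v + 1), ENNReal.ofReal (formWeight A i (t i.castSucc))) *
        f (t (Fin.last (v + 1)))) :=
    ((measurable_prod_formWeight A (v + 1)).mul (hf.comp (measurable_pi_apply _))).indicator
      (measurableSet_chainRegion A _)
  have he := (volume_preserving_piFinSuccAbove (fun _ : Fin (v + 2) => ℝ)
    (Fin.last (v + 1))).symm
  rw [chainLIntegral, chainLIntegral, ← lintegral_indicator (measurableSet_chainRegion A _),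
    ← lintegral_indicator (measurableSet_chainRegion A _), ← he.lintegral_comp hmeas,
    Measure.volume_eq_prod]
  refine (lintegral_prod_symm' _ (hmeas.comp he.measurable)).trans ?_
  refine lintegral_congr fun y => ?_
  have hsymm : ∀ x : ℝ, (MeasurableEquiv.piFinSuccAbove (fun _ : Fin (v + 2) => ℝ)
      (Fin.last (v + 1))).symm (x, y) = (Fin.snoc y x : Fin (v + 2) → ℝ) := fun x =>
    Fin.insertNth_last' x y
  simp only [Function.comp_apply, hsymm]
  by_cases hy : y ∈ chainRegion A (v + 1)
  · rw [Set.indicator_of_mem hy, ← mul_assoc, ← lintegral_const_mul _ hf,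
      ← lintegral_indicator (measurableSet_lastRange A v _)]
    refine lintegral_congr fun x => ?_
    by_cases hx : x ∈ lastRange A v (y (Fin.last v))
    · rw [Set.indicator_of_mem hx, Set.indicator_of_mem (snoc_mem_chainRegion.2 ⟨hy, hx⟩),
        Fin.prod_univ_castSucc]
      simp
    · rw [Set.indicator_of_notMem hx,
        Set.indicator_of_notMem fun h => hx (snoc_mem_chainRegion.1 h).2]
  · rw [Set.indicator_of_notMem hy, ← lintegral_zero (μ := (volume : Measure ℝ))]
    refine lintegral_congr fun x => ?_
    rw [Set.indicator_of_notMem fun h => hy (snoc_mem_chainRegion.1 h).1]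

lemma lintegral_one_sub_pow {a b : ℝ} (hab : a ≤ b) (hb : b ≤ 1) (n : ℕ) :
    ∫⁻ x in Set.Ioo a b, ENNReal.ofReal ((1 - x) ^ n) =
      ENNReal.ofReal (((1 - a) ^ (n + 1) - (1 - b) ^ (n + 1)) / (n + 1)) := by
  have hc : Continuous fun x : ℝ => (1 - x) ^ n := by fun_prop
  rw [← ofReal_integral_eq_lintegral_ofReal, ← integral_Ioc_eq_integral_Ioo,
    ← intervalIntegral.integral_of_le hab,
    intervalIntegral.integral_comp_sub_left (fun x => x ^ n), integral_pow]
  · exact (hc.integrableOn_Icc (a := a) (b := b)).mono_set Set.Ioo_subset_Icc_self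
  · filter_upwards [ae_restrict_mem measurableSet_Ioo] with x hx
    exact pow_nonneg (by linarith [hx.2]) n

lemma formWeight_mul_lintegral (A : Finset ℕ) (v n : ℕ) {s : ℝ} (hs : s ∈ Set.Ioo (0 : ℝ) 1) :
    ENNReal.ofReal (formWeight A v s) *
        ∫⁻ x in lastRange A v s, ENNReal.ofReal ((1 - x) ^ n) =
      if v + 1 ∈ A then ENNReal.ofReal (1 / (n + 1)) * ENNReal.ofReal ((1 - s) ^ n)
      else ENNReal.ofReal (1 / (n + 1)) *
        ∑ m ∈ Finset.range (n + 1), ENNReal.ofReal ((1 - s) ^ m) := by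
  obtain ⟨h0, h1⟩ := hs
  have hn : (0 : ℝ) < n + 1 := by positivity
  have h1' : 0 < 1 - s := by linarith
  have hw := formWeight_nonneg A v ⟨h0, h1⟩
  unfold formWeight at hw ⊢
  unfold lastRange
  split_ifs at hw ⊢ with hA
  · have hset : {x : ℝ | x ∈ Set.Ioo (0 : ℝ) 1 ∧ s < x} = Set.Ioo s 1 := by
      ext x
      simp only [Set.mem_ofPred_eq, Set.mem_Ioo]
      exact ⟨fun h => ⟨h.2, h.1.2⟩, fun h => ⟨⟨h0.trans h.1, h.2⟩, h.1⟩⟩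
    rw [hset, lintegral_one_sub_pow h1.le le_rfl, ← ENNReal.ofReal_mul hw,
      ← ENNReal.ofReal_mul (by positivity)]
    congr 1
    simp
    field_simp
    ring
  · have hset : {x : ℝ | x ∈ Set.Ioo (0 : ℝ) 1 ∧ x < s} = Set.Ioo 0 s := by
      ext x
      simp only [Set.mem_ofPred_eq, Set.mem_Ioo]
      exact ⟨fun h => ⟨h.1.1, h.2⟩, fun h => ⟨⟨h.1, h.2.trans h1⟩, h.2⟩⟩
    rw [hset, lintegral_one_sub_pow h0.le h1.le, ← ENNReal.ofReal_mul hw,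
      ← ENNReal.ofReal_sum_of_nonneg fun m _ => pow_nonneg h1'.le m,
      ← ENNReal.ofReal_mul (by positivity)]
    congr 1
    have := geom_sum_mul_neg (1 - s) (n + 1)
    rw [sub_sub_cancel] at this
    rw [sub_zero, one_pow, ← this]
    field_simp

lemma chainLIntegral_pow (A : Finset ℕ) (v n : ℕ) :
    chainLIntegral A v (fun x => ENNReal.ofReal ((1 - x) ^ n)) =
      ENNReal.ofReal (moment A v n) := by
  have hpow : ∀ m : ℕ, Measurable fun x : ℝ => ENNReal.ofReal ((1 - x) ^ m) := fun m => by
    fun_prop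
  have hint : ∀ v m : ℕ, Measurable fun t : Fin (v + 1) → ℝ =>
      (∏ i : Fin v, ENNReal.ofReal (formWeight A i (t i.castSucc))) *
        ENNReal.ofReal ((1 - t (Fin.last v)) ^ m) := fun v m =>
    (measurable_prod_formWeight A v).mul ((hpow m).comp (measurable_pi_apply _))
  induction v generalizing n with
  | zero =>
    have he := (volume_preserving_funUnique (Fin 1) ℝ)
    have hset : chainRegion A (0 + 1) = (MeasurableEquiv.funUnique (Fin 1) ℝ) ⁻¹' Set.Ioo 0 1 := by
      ext t
      refine ⟨fun h => h.1 default, fun h => ⟨fun j => ?_, fun i hi => absurd hi (by omega)⟩⟩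
      rw [Subsingleton.elim (α := Fin 1) j default]
      exact h
    have := he.setLIntegral_comp_preimage (measurableSet_Ioo (a := (0 : ℝ)) (b := 1)) (hpow n)
    rw [chainLIntegral, hset]
    simp only [Finset.univ_eq_empty, Finset.prod_empty, one_mul]
    refine this.trans ?_
    rw [lintegral_one_sub_pow zero_le_one le_rfl, moment]
    simp
  | succ v ih =>
    rw [chainLIntegral_succ A v (hpow n), chainLIntegral]
    have hcongr := fun (t : Fin (v + 1) → ℝ) (ht : t ∈ chainRegion A (v + 1)) =>
      congrArg ((∏ i : Fin v, ENNReal.ofReal (formWeight A i (t i.castSucc))) * ·)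
        (formWeight_mul_lintegral A v n (ht.1 (Fin.last v)))
    rw [setLIntegral_congr_fun (measurableSet_chainRegion A _) hcongr, moment]
    split_ifs
    · simp only [mul_left_comm _ (ENNReal.ofReal (1 / ((n : ℝ) + 1)))]
      rw [lintegral_const_mul _ (hint v n)]
      refine (congrArg _ (ih n)).trans ?_
      rw [← ENNReal.ofReal_mul (by positivity), one_div_mul_eq_div]
    · simp only [mul_left_comm _ (ENNReal.ofReal (1 / ((n : ℝ) + 1)))]
      simp only [Finset.mul_sum (Finset.range (n + 1)) _ (Finset.prod _ _)]
      rw [lintegral_const_mul _ (Finset.measurable_fun_sum _ fun m _ => hint v m),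
        lintegral_finsetSum _ fun m _ => hint v m]
      have : ∀ m ∈ Finset.range (n + 1), ∫⁻ t in chainRegion A (v + 1),
          (∏ i : Fin v, ENNReal.ofReal (formWeight A i (t i.castSucc))) *
            ENNReal.ofReal ((1 - t (Fin.last v)) ^ m) = ENNReal.ofReal (moment A v m) :=
        fun m _ => ih m
      rw [Finset.sum_congr rfl this, ← ENNReal.ofReal_sum_of_nonneg fun m _ => moment_nonneg A v m,
        ← ENNReal.ofReal_mul (by positivity), one_div_mul_eq_div]

lemma tsum_eq_integral_chainRegion (A : Finset ℕ) (v : ℕ) (z : ℂ) (hz : -1 < z.re) :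
    ∑' n : ℕ, (-1 : ℂ) ^ n * ((moment A v n : ℝ) : ℂ) * cbinom z (n + 1) =
      ∫ t in chainRegion A (v + 1), ((∏ i : Fin v, formWeight A i (t i.castSucc) : ℝ) : ℂ) *
        ((1 - ((t (Fin.last v) : ℝ) : ℂ) ^ z) / (1 - ((t (Fin.last v) : ℝ) : ℂ))) := by
  set φ : ℕ → (Fin (v + 1) → ℝ) → ℝ := fun n t =>
    (∏ i : Fin v, formWeight A i (t i.castSucc)) * (1 - t (Fin.last v)) ^ n with hφ
  set c : ℕ → ℂ := fun n => (-1 : ℂ) ^ n * cbinom z (n + 1) with hc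
  have hmem := ae_restrict_mem (μ := volume) (measurableSet_chainRegion A (v + 1))
  have hprod : ∀ t ∈ chainRegion A (v + 1), 0 ≤ ∏ i : Fin v, formWeight A i (t i.castSucc) :=
    fun t ht => Finset.prod_nonneg fun i _ => formWeight_nonneg A i (ht.1 _)
  have hφ0 : ∀ n, ∀ t ∈ chainRegion A (v + 1), 0 ≤ φ n t := fun n t ht =>
    mul_nonneg (hprod t ht) (pow_nonneg (by linarith [(ht.1 (Fin.last v)).2]) n)
  have hφ0' : ∀ n, 0 ≤ᵐ[volume.restrict (chainRegion A (v + 1))] φ n := fun n =>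
    hmem.mono fun t ht => hφ0 n t ht
  have hφm : ∀ n, Measurable (φ n) := fun n => by
    have h1 : Measurable fun t : Fin (v + 1) → ℝ =>
        ∏ i : Fin v, formWeight A i (t i.castSucc) :=
      Finset.measurable_fun_prod _ fun i _ =>
        (measurable_formWeight A i).comp (measurable_pi_apply _)
    exact h1.mul ((measurable_const.sub (measurable_pi_apply _)).pow_const n)
  have hφl : ∀ n, ∫⁻ t in chainRegion A (v + 1), ENNReal.ofReal (φ n t) =
      ENNReal.ofReal (moment A v n) := fun n => by
    rw [← chainLIntegral_pow, chainLIntegral]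
    refine setLIntegral_congr_fun (measurableSet_chainRegion A _) fun t ht => ?_
    simp only [hφ]
    rw [ENNReal.ofReal_mul (hprod t ht),
      ENNReal.ofReal_prod_of_nonneg (s := Finset.univ)
        (f := fun i : Fin v => formWeight A i (t i.castSucc)) fun i _ =>
          formWeight_nonneg A i (ht.1 _)]
  have hφi : ∀ n, Integrable (φ n) (volume.restrict (chainRegion A (v + 1))) := fun n => by
    rw [← lintegral_ofReal_ne_top_iff_integrable (hφm n).aestronglyMeasurable (hφ0' n), hφl n]
    exact ENNReal.ofReal_ne_top
  have hφint : ∀ n, ∫ t in chainRegion A (v + 1), φ n t = moment A v n := fun n => by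
    rw [integral_eq_lintegral_of_nonneg_ae (hφ0' n) (hφm n).aestronglyMeasurable, hφl n,
      ENNReal.toReal_ofReal (moment_nonneg A v n)]
  have hnorm : ∀ n, ∫ t in chainRegion A (v + 1), ‖c n * ((φ n t : ℝ) : ℂ)‖ =
      ‖cbinom z (n + 1)‖ * moment A v n := fun n => by
    rw [← hφint n, ← integral_const_mul]
    refine setIntegral_congr_fun (measurableSet_chainRegion A _) fun t ht => ?_
    simp only [hc, norm_mul, norm_pow, norm_neg, norm_one, one_pow, one_mul, Complex.norm_real,
      Real.norm_eq_abs, abs_of_nonneg (hφ0 n t ht)]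
  have hsum := hasSum_integral_of_summable_integral_norm
    (F := fun n t => c n * ((φ n t : ℝ) : ℂ)) (fun n => (hφi n).ofReal.const_mul (c n))
    (by simpa only [hnorm] using summable_norm_cbinom_mul_moment A v z hz)
  have hterm : ∀ n, ∫ t in chainRegion A (v + 1), c n * ((φ n t : ℝ) : ℂ) =
      (-1 : ℂ) ^ n * ((moment A v n : ℝ) : ℂ) * cbinom z (n + 1) := fun n => by
    rw [integral_const_mul, integral_complex_ofReal, hφint n]
    ring
  simp only [hterm] at hsum
  rw [hsum.tsum_eq]
  refine setIntegral_congr_fun (measurableSet_chainRegion A _) fun t ht => ?_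
  rw [← ((hasSum_cbinom_one_sub_pow z (ht.1 (Fin.last v))).mul_left _).tsum_eq]
  refine tsum_congr fun n => ?_
  simp only [hc, hφ]
  push_cast
  ring

lemma tsum_sStar_compositionOf_eq_integral (A : Finset ℕ) (w : ℕ) (hw : 0 < w) (z : ℂ)
    (hz : -1 < z.re) :
    ∑' n : ℕ, (-1 : ℂ) ^ n *
        ((sStar (compositionOf w (Finset.Icc 1 (w - 1) \ A)) (n + 1) : ℝ) : ℂ) *
          cbinom z (n + 1) =
      ∫ t in chainRegion A w,
        ∏ i : Fin w,
          if (i : ℕ) + 1 = w then (1 - ((t i : ℝ) : ℂ) ^ z) / (1 - ((t i : ℝ) : ℂ))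
          else if (i : ℕ) + 1 ∈ A then 1 / (1 - ((t i : ℝ) : ℂ))
          else 1 / ((t i : ℝ) : ℂ) := by
  obtain ⟨v, rfl⟩ : ∃ v, w = v + 1 := ⟨w - 1, by omega⟩
  simp only [Nat.add_sub_cancel, sStar_compositionOf]
  rw [tsum_eq_integral_chainRegion A v z hz]
  refine integral_congr_ae (Eventually.of_forall fun t => ?_)
  simp only
  rw [Fin.prod_univ_castSucc, Complex.ofReal_prod]
  congr 1
  · refine Finset.prod_congr rfl fun i _ => ?_
    have hi : ((i.castSucc : Fin (v + 1)) : ℕ) + 1 ≠ v + 1 := by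
      have := i.2
      simp
      omega
    rw [if_neg hi, formWeight]
    simp only [Fin.val_castSucc]
    split_ifs <;> push_cast <;> rfl
  · simp

/-- Integral representation of the Kawashima function:
`F_k(z) = ∫_{Δ(k)} ω_{δ(1)}(t₁) ⋯ ω_{δ(k-1)}(t_{k-1}) · (1 - t_k^z)/(1 - t_k) dt_k`
for `Re(z) > -1`. -/
theorem F_eq_integral (k : List ℕ) (hk : k ≠ []) (hpos : ∀ x ∈ k, 0 < x)
    (z : ℂ) (hz : -1 < z.re) :
    F k z =
      ∫ t in Delta k,
        ∏ i : Fin k.sum,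
          if (i : ℕ) + 1 = k.sum then (1 - ((t i : ℝ) : ℂ) ^ z) / (1 - ((t i : ℝ) : ℂ))
          else if (i : ℕ) + 1 ∈ Aset k then 1 / (1 - ((t i : ℝ) : ℂ))
          else 1 / ((t i : ℝ) : ℂ) := by
  have hw : 0 < k.sum := by
    obtain ⟨a, ha⟩ := List.exists_mem_of_ne_nil k hk
    exact (hpos a ha).trans_le (List.single_le_sum (fun _ _ => Nat.zero_le _) a ha)
  rw [F, if_neg hk]
  exact tsum_sStar_compositionOf_eq_integral (Aset k) k.sum hw z hz

end Kawashima
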